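/- arXiv:1903.02509 — 3 statements merged into one kernel-verified Lean document; each statement's English description precedes it below -/
import Mathlib

section
/- Let $0 < \beta < d$, $t > 0$, and suppose $\eta : [0,t] \to \mathbb{R}$ is bounded and measurable. With $\varphi_R(s,y) = \int_{B_R} p_{t-s}(x-y)\,dx$, one has $\lim_{R \to +\infty} R^{\beta - 2d} \int_0^t \eta^2(s) \int_{\mathbb{R}^{2d}} \varphi_R(s, \xi + z)\varphi_R(s, z) |\xi|^{-\beta} \, d\xi \, dz \, ds = k_\beta \int_0^t \eta^2(s)\, ds$, where $k_\beta = \int_{B_1^2} |x_1 - x_2|^{-\beta}\, dx_1 dx_2$. -/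
open MeasureTheory Real Filter

/-- The `d`-dimensional heat kernel. -/
noncomputable def heatKernel (d : ℕ) (t : ℝ) (x : EuclideanSpace ℝ (Fin d)) : ℝ :=
  (2 * π * t) ^ (-(d : ℝ) / 2) * Real.exp (-‖x‖ ^ 2 / (2 * t))

open Set Topology

/-- standard Gaussian density -/
noncomputable def gd (d : ℕ) (w : EuclideanSpace ℝ (Fin d)) : ℝ :=
  (2 * π) ^ (-(d : ℝ) / 2) * Real.exp (-(1 / 2) * ‖w‖ ^ 2)

noncomputable def bi (d : ℕ) (x : EuclideanSpace ℝ (Fin d)) : ℝ :=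
  (Metric.closedBall (0 : EuclideanSpace ℝ (Fin d)) 1).indicator (fun _ => (1 : ℝ)) x

noncomputable def psi (d : ℕ) (σ : ℝ) (z : EuclideanSpace ℝ (Fin d)) : ℝ :=
  ∫ w, bi d (z + σ • w) * gd d w

noncomputable def FF (d : ℕ) (β σ : ℝ) (p : EuclideanSpace ℝ (Fin d) × EuclideanSpace ℝ (Fin d)) : ℝ :=
  psi d σ (p.1 + p.2) * psi d σ p.2 * ‖p.1‖ ^ (-β)

lemma gauss_int (d : ℕ) {b : ℝ} (hb : 0 < b) :
    Integrable (fun w : EuclideanSpace ℝ (Fin d) => Real.exp (-b * ‖w‖ ^ 2)) := by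
  have h := GaussianFourier.integral_rexp_neg_mul_sq_norm (V := EuclideanSpace ℝ (Fin d)) hb
  by_contra hc
  rw [integral_undef hc] at h
  have : 0 < (π / b) ^ ((Module.finrank ℝ (EuclideanSpace ℝ (Fin d)) : ℝ) / 2) := by positivity
  linarith

lemma gd_nonneg (d : ℕ) (w) : 0 ≤ gd d w := by unfold gd; positivity

lemma gd_integrable (d : ℕ) : Integrable (gd d) :=
  (gauss_int d (by norm_num : (0 : ℝ) < 1 / 2)).const_mul _

lemma gd_integral (d : ℕ) : ∫ w, gd d w = 1 := by
  unfold gd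
  rw [integral_const_mul, GaussianFourier.integral_rexp_neg_mul_sq_norm (by norm_num)]
  rw [finrank_euclideanSpace_fin, show π / (1 / 2) = 2 * π by ring, ← rpow_add (by positivity)]
  rw [show -(d : ℝ) / 2 + d / 2 = 0 by ring, rpow_zero]

lemma gd_cont (d : ℕ) : Continuous (gd d) := by unfold gd; fun_prop

lemma bi_meas (d : ℕ) : Measurable (bi d) :=
  measurable_const.indicator measurableSet_closedBall

lemma bi_nonneg (d : ℕ) (x) : 0 ≤ bi d x := indicator_nonneg (fun _ _ => zero_le_one) _

lemma bi_le_one (d : ℕ) (x) : bi d x ≤ 1 := by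
  unfold bi; exact indicator_le_self' (fun _ _ => zero_le_one) x

lemma bi_eq (d : ℕ) (x) : bi d x = if ‖x‖ ≤ 1 then 1 else 0 := by
  classical
  simp [bi, indicator_apply]

lemma psi_meas (d : ℕ) :
    Measurable (fun p : ℝ × EuclideanSpace ℝ (Fin d) => psi d p.1 p.2) := by
  have h1 : Measurable (fun q : (ℝ × EuclideanSpace ℝ (Fin d)) × EuclideanSpace ℝ (Fin d) =>
    q.1.2 + q.1.1 • q.2) := by fun_prop
  have h2 : Measurable (fun q : (ℝ × EuclideanSpace ℝ (Fin d)) × EuclideanSpace ℝ (Fin d) =>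
    bi d (q.1.2 + q.1.1 • q.2) * gd d q.2) :=
    ((bi_meas d).comp h1).mul ((gd_cont d).measurable.comp measurable_snd)
  have h3 := (h2.stronglyMeasurable.integral_prod_right'
    (ν := (volume : Measure (EuclideanSpace ℝ (Fin d)))))
  exact h3.measurable

lemma psi_nonneg (d : ℕ) (σ z) : 0 ≤ psi d σ z :=
  integral_nonneg fun _ => mul_nonneg (bi_nonneg _ _) (gd_nonneg _ _)

lemma psi_zero (d : ℕ) (z) : psi d 0 z = bi d z := by
  unfold psi
  simp [integral_const_mul, gd_integral]

lemma psi_tendsto (d : ℕ) (z : EuclideanSpace ℝ (Fin d)) (hz : ‖z‖ ≠ 1) :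
    Tendsto (fun σ => psi d σ z) (𝓝 0) (𝓝 (psi d 0 z)) := by
  unfold psi
  apply tendsto_integral_filter_of_dominated_convergence (gd d)
  · refine Eventually.of_forall fun σ => Measurable.aestronglyMeasurable ?_
    have h1 : Measurable (fun w : EuclideanSpace ℝ (Fin d) => z + σ • w) := by fun_prop
    exact ((bi_meas d).comp h1).mul (gd_cont d).measurable
  · refine Eventually.of_forall fun σ => Eventually.of_forall fun w => ?_
    rw [Real.norm_of_nonneg (mul_nonneg (bi_nonneg _ _) (gd_nonneg _ _))]
    exact mul_le_of_le_one_left (gd_nonneg _ _) (bi_le_one _ _)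
  · exact gd_integrable d
  · refine Eventually.of_forall fun w => ?_
    have hc : Tendsto (fun σ : ℝ => ‖z + σ • w‖) (𝓝 0) (𝓝 ‖z‖) := by
      have : Continuous (fun σ : ℝ => ‖z + σ • w‖) := by fun_prop
      simpa using this.tendsto 0
    apply Tendsto.mul_const
    apply tendsto_const_nhds.congr'
    rcases lt_or_gt_of_ne hz with h | h
    · filter_upwards [hc.eventually_lt_const h] with σ hσ
      rw [bi_eq, bi_eq, if_pos hσ.le, if_pos (by simpa using h.le)]
    · filter_upwards [hc.eventually_const_lt h] with σ hσ
      rw [bi_eq, bi_eq, if_neg hσ.not_ge, if_neg (by simpa using h)]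

lemma psi_bound (d : ℕ) : ∃ C : ℝ, 0 ≤ C ∧ ∀ σ ∈ Icc (0 : ℝ) 1, ∀ z,
    psi d σ z ≤ C * Real.exp (-(1 / 8) * ‖z‖ ^ 2) := by
  refine ⟨∫ w : EuclideanSpace ℝ (Fin d), Real.exp (1 / 4) * ((2 * π) ^ (-(d : ℝ) / 2) *
      Real.exp (-(1 / 4) * ‖w‖ ^ 2)), integral_nonneg fun _ => by positivity, ?_⟩
  intro σ hσ z
  rw [← integral_mul_const]
  unfold psi
  apply integral_mono_of_nonneg
  · exact Eventually.of_forall fun _ => mul_nonneg (bi_nonneg _ _) (gd_nonneg _ _)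
  · exact (((gauss_int d (by norm_num : (0 : ℝ) < 1 / 4)).const_mul _).const_mul _).mul_const _
  · refine Eventually.of_forall fun w => ?_
    simp only
    rw [bi_eq]
    split_ifs with h
    · have h1 : ‖z‖ ≤ 1 + ‖w‖ := by
        have e : z = (z + σ • w) - σ • w := by abel
        calc ‖z‖ = ‖(z + σ • w) - σ • w‖ := by rw [← e]
          _ ≤ ‖z + σ • w‖ + ‖σ • w‖ := norm_sub_le _ _
          _ ≤ 1 + ‖w‖ := by
            rw [norm_smul, Real.norm_of_nonneg hσ.1]
            have := mul_le_of_le_one_left (norm_nonneg w) hσ.2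
            linarith
      have h2 : ‖z‖ ^ 2 ≤ 2 + 2 * ‖w‖ ^ 2 := by
        nlinarith [norm_nonneg z, norm_nonneg w, sq_nonneg (1 - ‖w‖)]
      unfold gd
      have : Real.exp (-(1 / 2) * ‖w‖ ^ 2) ≤ Real.exp (1 / 4) * Real.exp (-(1 / 4) * ‖w‖ ^ 2) *
          Real.exp (-(1 / 8) * ‖z‖ ^ 2) := by
        rw [← Real.exp_add, ← Real.exp_add]
        apply Real.exp_le_exp.2
        linarith
      calc _ = (2 * π) ^ (-(d : ℝ) / 2) * Real.exp (-(1 / 2) * ‖w‖ ^ 2) := one_mul _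
        _ ≤ (2 * π) ^ (-(d : ℝ) / 2) * (Real.exp (1 / 4) * Real.exp (-(1 / 4) * ‖w‖ ^ 2) *
          Real.exp (-(1 / 8) * ‖z‖ ^ 2)) := by gcongr
        _ = _ := by ring
    · rw [zero_mul]; positivity

lemma riesz_int (d : ℕ) (β : ℝ) (hβ0 : 0 < β) (hβd : β < d) {b : ℝ} (hb : 0 < b) :
    Integrable (fun w : EuclideanSpace ℝ (Fin d) => Real.exp (-b * ‖w‖ ^ 2) * ‖w‖ ^ (-β)) := by
  have hd : 0 < d := by
    have : (0 : ℝ) < d := hβ0.trans hβd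
    exact_mod_cast this
  haveI : Nonempty (Fin d) := ⟨⟨0, hd⟩⟩
  rw [integrable_fun_norm_addHaar volume (f := fun y => Real.exp (-b * y ^ 2) * y ^ (-β))]
  have h := integrableOn_rpow_mul_exp_neg_mul_sq hb (s := (d : ℝ) - 1 - β) (by linarith)
  refine h.congr_fun ?_ measurableSet_Ioi
  intro y hy
  have hy' : (0 : ℝ) < y := hy
  simp only [finrank_euclideanSpace_fin, smul_eq_mul]
  rw [sub_eq_add_neg, rpow_add hy', ← rpow_natCast y (d - 1), Nat.cast_sub hd]
  push_cast
  ring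

lemma FF_meas (d : ℕ) (β : ℝ) : Measurable (fun q : ℝ × (EuclideanSpace ℝ (Fin d) ×
    EuclideanSpace ℝ (Fin d)) => FF d β q.1 q.2) := by
  unfold FF
  have h1 : Measurable (fun q : ℝ × (EuclideanSpace ℝ (Fin d) × EuclideanSpace ℝ (Fin d)) =>
    psi d q.1 (q.2.1 + q.2.2)) := (psi_meas d).comp
      (g := fun p : ℝ × EuclideanSpace ℝ (Fin d) => psi d p.1 p.2)
      (f := fun q : ℝ × (EuclideanSpace ℝ (Fin d) × EuclideanSpace ℝ (Fin d)) =>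
        (q.1, q.2.1 + q.2.2)) (by fun_prop)
  have h2 : Measurable (fun q : ℝ × (EuclideanSpace ℝ (Fin d) × EuclideanSpace ℝ (Fin d)) =>
    psi d q.1 q.2.2) := (psi_meas d).comp
      (g := fun p : ℝ × EuclideanSpace ℝ (Fin d) => psi d p.1 p.2)
      (f := fun q : ℝ × (EuclideanSpace ℝ (Fin d) × EuclideanSpace ℝ (Fin d)) =>
        (q.1, q.2.2)) (by fun_prop)
  exact (h1.mul h2).mul (by fun_prop)

lemma FF_nonneg (d : ℕ) (β σ p) : 0 ≤ FF d β σ p :=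
  mul_nonneg (mul_nonneg (psi_nonneg _ _ _) (psi_nonneg _ _ _)) (by positivity)

lemma FF_bound (d : ℕ) (β : ℝ) (hβ0 : 0 < β) (hβd : β < d) :
    ∃ D : EuclideanSpace ℝ (Fin d) × EuclideanSpace ℝ (Fin d) → ℝ, Integrable D ∧
      ∀ σ ∈ Icc (0 : ℝ) 1, ∀ p, ‖FF d β σ p‖ ≤ D p := by
  obtain ⟨C, hC, hb⟩ := psi_bound d
  refine ⟨fun p => C ^ 2 * ((Real.exp (-(1 / 32) * ‖p.1‖ ^ 2) * ‖p.1‖ ^ (-β)) *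
    Real.exp (-(1 / 16) * ‖p.2‖ ^ 2)), ?_, ?_⟩
  · exact ((riesz_int d β hβ0 hβd (by norm_num : (0 : ℝ) < 1 / 32)).mul_prod
      (gauss_int d (by norm_num : (0 : ℝ) < 1 / 16))).const_mul _
  · rintro σ hσ ⟨ξ, z⟩
    rw [Real.norm_of_nonneg (FF_nonneg _ _ _ _)]
    unfold FF
    simp only
    have h1 : ‖ξ‖ ≤ ‖ξ + z‖ + ‖z‖ := by
      simpa using norm_sub_le (ξ + z) z
    have h2 : ‖ξ‖ ^ 2 ≤ 2 * ‖ξ + z‖ ^ 2 + 2 * ‖z‖ ^ 2 := by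
      nlinarith [norm_nonneg z, norm_nonneg ξ, norm_nonneg (ξ + z), sq_nonneg (‖ξ + z‖ - ‖z‖)]
    calc psi d σ (ξ + z) * psi d σ z * ‖ξ‖ ^ (-β)
        ≤ (C * Real.exp (-(1 / 8) * ‖ξ + z‖ ^ 2)) * (C * Real.exp (-(1 / 8) * ‖z‖ ^ 2)) *
          ‖ξ‖ ^ (-β) := by
          gcongr
          · exact psi_nonneg _ _ _
          · exact hb σ hσ _
          · exact hb σ hσ _
      _ = C ^ 2 * (Real.exp (-(1 / 8) * ‖ξ + z‖ ^ 2) * Real.exp (-(1 / 8) * ‖z‖ ^ 2)) *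
          ‖ξ‖ ^ (-β) := by ring
      _ ≤ C ^ 2 * (Real.exp (-(1 / 32) * ‖ξ‖ ^ 2) * Real.exp (-(1 / 16) * ‖z‖ ^ 2)) *
          ‖ξ‖ ^ (-β) := by
          apply mul_le_mul_of_nonneg_right _ (by positivity)
          apply mul_le_mul_of_nonneg_left _ (by positivity)
          rw [← Real.exp_add, ← Real.exp_add]
          apply Real.exp_le_exp.2
          nlinarith [sq_nonneg ‖ξ + z‖]
      _ = _ := by ring

lemma FF_integrable (d : ℕ) (β : ℝ) (hβ0 : 0 < β) (hβd : β < d) (σ : ℝ) (hσ : σ ∈ Icc (0 : ℝ) 1) :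
    Integrable (FF d β σ) := by
  obtain ⟨D, hD, hb⟩ := FF_bound d β hβ0 hβd
  exact hD.mono' ((FF_meas d β).comp measurable_prodMk_left).aestronglyMeasurable
    (Eventually.of_forall (hb σ hσ))

lemma ae_norm_ne (d : ℕ) : ∀ᵐ z : EuclideanSpace ℝ (Fin d), ‖z‖ ≠ 1 := by
  have h := Measure.addHaar_sphere_of_ne_zero (volume : Measure (EuclideanSpace ℝ (Fin d))) 0
    (one_ne_zero (α := ℝ))
  filter_upwards [measure_eq_zero_iff_ae_notMem.1 h] with z hz
  simpa using hz

lemma PHI_tendsto (d : ℕ) (β : ℝ) (hβ0 : 0 < β) (hβd : β < d) :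
    Tendsto (fun σ => ∫ p, FF d β σ p) (𝓝[Icc 0 1] 0) (𝓝 (∫ p, FF d β 0 p)) := by
  obtain ⟨D, hD, hb⟩ := FF_bound d β hβ0 hβd
  apply tendsto_integral_filter_of_dominated_convergence D
  · exact Eventually.of_forall fun σ =>
      ((FF_meas d β).comp measurable_prodMk_left).aestronglyMeasurable
  · filter_upwards [self_mem_nhdsWithin] with σ hσ
    exact Eventually.of_forall (hb σ hσ)
  · exact hD
  · have h2 : ∀ᵐ p : EuclideanSpace ℝ (Fin d) × EuclideanSpace ℝ (Fin d), ‖p.2‖ ≠ 1 :=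
      Measure.quasiMeasurePreserving_snd.ae (ae_norm_ne d)
    have h1 : ∀ᵐ p : EuclideanSpace ℝ (Fin d) × EuclideanSpace ℝ (Fin d), ‖p.1 + p.2‖ ≠ 1 := by
      have hm : MeasurableSet {p : EuclideanSpace ℝ (Fin d) × EuclideanSpace ℝ (Fin d) |
          ‖p.1 + p.2‖ ≠ 1} := by
        apply MeasurableSet.compl
        exact measurableSet_eq_fun (by fun_prop) measurable_const
      refine (Measure.ae_prod_iff_ae_ae hm).2 (Eventually.of_forall fun ξ => ?_)
      exact (measurePreserving_add_left volume ξ).quasiMeasurePreserving.ae (ae_norm_ne d)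
    filter_upwards [h1, h2] with p hp1 hp2
    exact (((psi_tendsto d _ hp1).mul (psi_tendsto d _ hp2)).mul_const _).mono_left
      nhdsWithin_le_nhds

lemma PHI_zero (d : ℕ) (β : ℝ) (hβ0 : 0 < β) (hβd : β < d) :
    ∫ p, FF d β 0 p = ∫ x₁ in Metric.closedBall (0 : EuclideanSpace ℝ (Fin d)) 1,
          ∫ x₂ in Metric.closedBall (0 : EuclideanSpace ℝ (Fin d)) 1, ‖x₁ - x₂‖ ^ (-β) := by
  have hI := FF_integrable d β hβ0 hβd 0 (by simp)
  rw [show (∫ p, FF d β 0 p) = ∫ p, FF d β 0 p ∂(volume.prod volume) from rfl,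
    integral_prod_symm _ hI, ← integral_indicator measurableSet_closedBall]
  congr 1 with z
  rw [← integral_sub_right_eq_self (μ := volume) (fun ξ => FF d β 0 (ξ, z)) z]
  by_cases hz : z ∈ Metric.closedBall (0 : EuclideanSpace ℝ (Fin d)) 1
  · rw [indicator_of_mem hz, ← integral_indicator measurableSet_closedBall]
    congr 1 with x
    have hz1 : bi d z = 1 := indicator_of_mem hz _
    simp only [FF, psi_zero, sub_add_cancel, hz1, mul_one]
    rw [norm_sub_rev]
    unfold bi
    by_cases hx : x ∈ Metric.closedBall (0 : EuclideanSpace ℝ (Fin d)) 1 <;> simp [hx, indicator]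
  · rw [indicator_of_notMem hz]
    have hz1 : bi d z = 0 := indicator_of_notMem hz _
    simp [FF, psi_zero, hz1]

lemma phi_eq (d : ℕ) (u R : ℝ) (hu : 0 < u) (hR : 0 < R) (z : EuclideanSpace ℝ (Fin d)) :
    (∫ x in Metric.closedBall (0 : EuclideanSpace ℝ (Fin d)) R, heatKernel d u (x - z)) =
      psi d (√u / R) (R⁻¹ • z) := by
  rw [← integral_indicator measurableSet_closedBall,
    ← integral_add_right_eq_self (μ := volume) _ z]
  have hs : 0 < √u := Real.sqrt_pos.2 hu
  have h := Measure.integral_comp_smul (volume : Measure (EuclideanSpace ℝ (Fin d)))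
    (fun x => (Metric.closedBall (0 : EuclideanSpace ℝ (Fin d)) R).indicator
      (fun x => heatKernel d u (x - z)) (x + z)) (√u)
  rw [finrank_euclideanSpace_fin, abs_of_pos (by positivity), smul_eq_mul] at h
  have h' : (∫ x, (Metric.closedBall (0 : EuclideanSpace ℝ (Fin d)) R).indicator
      (fun x => heatKernel d u (x - z)) (x + z)) = √u ^ d * ∫ x,
      (Metric.closedBall (0 : EuclideanSpace ℝ (Fin d)) R).indicator
      (fun x => heatKernel d u (x - z)) (√u • x + z) := by
    rw [h, ← mul_assoc, mul_inv_cancel₀ (by positivity), one_mul]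
  rw [h', ← integral_const_mul]
  unfold psi
  congr 1 with w
  have hb : bi d (R⁻¹ • z + (√u / R) • w) =
      (Metric.closedBall (0 : EuclideanSpace ℝ (Fin d)) R).indicator (fun _ => (1 : ℝ))
        (√u • w + z) := by
    classical
    rw [bi_eq, indicator_apply]
    have e : R⁻¹ • z + (√u / R) • w = R⁻¹ • (√u • w + z) := by
      rw [smul_add, smul_smul, add_comm, div_eq_inv_mul]
    rw [e, norm_smul, norm_inv, Real.norm_of_nonneg hR.le, mem_closedBall_zero_iff]
    simp only [inv_mul_le_iff₀ hR, mul_one]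
  have hk : √u ^ d * heatKernel d u (√u • w) = gd d w := by
    unfold heatKernel gd
    rw [norm_smul, Real.norm_of_nonneg hs.le, mul_pow, Real.sq_sqrt hu.le,
      mul_rpow (by positivity) hu.le, Real.sqrt_eq_rpow, ← rpow_natCast, ← rpow_mul hu.le]
    have e1 : u ^ (1 / 2 * (d : ℝ)) * u ^ (-(d : ℝ) / 2) = 1 := by
      rw [← rpow_add hu, show 1 / 2 * (d : ℝ) + -(d : ℝ) / 2 = 0 by ring, rpow_zero]
    have e2 : -(u * ‖w‖ ^ 2) / (2 * u) = -(1 / 2) * ‖w‖ ^ 2 := by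
      field_simp
    rw [e2]
    calc _ = (u ^ (1 / 2 * (d : ℝ)) * u ^ (-(d : ℝ) / 2)) * ((2 * π) ^ (-(d : ℝ) / 2) *
          Real.exp (-(1 / 2) * ‖w‖ ^ 2)) := by ring
      _ = _ := by rw [e1, one_mul]
  rw [hb, ← hk]
  by_cases hx : √u • w + z ∈ Metric.closedBall (0 : EuclideanSpace ℝ (Fin d)) R
  · rw [indicator_of_mem hx, indicator_of_mem hx]; simp
  · rw [indicator_of_notMem hx, indicator_of_notMem hx]; simp

lemma inner_eq (d : ℕ) (β : ℝ) (hβ0 : 0 < β) (hβd : β < d) (u R : ℝ) (hu : 0 < u) (hR : 0 < R)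
    (huR : √u ≤ R) :
    (∫ ξ : EuclideanSpace ℝ (Fin d), ∫ z : EuclideanSpace ℝ (Fin d),
      (∫ x in Metric.closedBall (0 : EuclideanSpace ℝ (Fin d)) R,
        heatKernel d u (x - (ξ + z))) *
      (∫ x in Metric.closedBall (0 : EuclideanSpace ℝ (Fin d)) R,
        heatKernel d u (x - z)) * ‖ξ‖ ^ (-β)) =
    R ^ (2 * d - β) * ∫ p, FF d β (√u / R) p := by
  simp_rw [phi_eq d u R hu hR]
  have hI := FF_integrable d β hβ0 hβd (√u / R) ⟨by positivity, (div_le_one hR).2 huR⟩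
  rw [show (∫ p, FF d β (√u / R) p) = ∫ p, FF d β (√u / R) p ∂(volume.prod volume) from rfl,
    integral_prod _ hI]
  have hn : ∀ ξ : EuclideanSpace ℝ (Fin d), ‖ξ‖ ^ (-β) = R ^ (-β) * ‖R⁻¹ • ξ‖ ^ (-β) := by
    intro ξ
    rw [← mul_rpow hR.le (norm_nonneg _), norm_smul, norm_inv, Real.norm_of_nonneg hR.le,
      mul_inv_cancel_left₀ hR.ne']
  have h1 : ∀ ξ : EuclideanSpace ℝ (Fin d),
      (∫ z, psi d (√u / R) (R⁻¹ • (ξ + z)) * psi d (√u / R) (R⁻¹ • z) * ‖ξ‖ ^ (-β)) =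
      (R ^ (-β) * R ^ d) * ∫ z, FF d β (√u / R) (R⁻¹ • ξ, z) := by
    intro ξ
    have := Measure.integral_comp_inv_smul (volume : Measure (EuclideanSpace ℝ (Fin d)))
      (fun z => FF d β (√u / R) (R⁻¹ • ξ, z)) R
    rw [finrank_euclideanSpace_fin, abs_of_pos (by positivity), smul_eq_mul] at this
    rw [mul_assoc, ← this, ← integral_const_mul]
    congr 1 with z
    simp only [FF]
    rw [hn ξ, smul_add]
    ring
  simp_rw [h1]
  rw [integral_const_mul]
  have := Measure.integral_comp_inv_smul (volume : Measure (EuclideanSpace ℝ (Fin d)))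
      (fun ξ => ∫ z, FF d β (√u / R) (ξ, z)) R
  rw [finrank_euclideanSpace_fin, abs_of_pos (by positivity), smul_eq_mul] at this
  rw [this, ← mul_assoc]
  congr 1
  rw [← rpow_natCast, ← rpow_add hR, ← rpow_add hR]
  congr 1; ring

theorem stmt_8 (d : ℕ) (β : ℝ) (hβ0 : 0 < β) (hβd : β < d) (t : ℝ) (ht : 0 < t)
    (η : ℝ → ℝ) (hη_meas : Measurable η) (M : ℝ) (hη_bdd : ∀ s ∈ Set.Icc 0 t, |η s| ≤ M) :
    Tendsto (fun R : ℝ =>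
        R ^ (β - 2 * d) *
          ∫ s in Set.Ioc (0 : ℝ) t, η s ^ 2 *
            ∫ ξ : EuclideanSpace ℝ (Fin d), ∫ z : EuclideanSpace ℝ (Fin d),
              (∫ x in Metric.closedBall (0 : EuclideanSpace ℝ (Fin d)) R,
                heatKernel d (t - s) (x - (ξ + z))) *
              (∫ x in Metric.closedBall (0 : EuclideanSpace ℝ (Fin d)) R,
                heatKernel d (t - s) (x - z)) * ‖ξ‖ ^ (-β))
      atTop
      (nhds ((∫ x₁ in Metric.closedBall (0 : EuclideanSpace ℝ (Fin d)) 1,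
          ∫ x₂ in Metric.closedBall (0 : EuclideanSpace ℝ (Fin d)) 1,
            ‖x₁ - x₂‖ ^ (-β)) * ∫ s in Set.Ioc (0 : ℝ) t, η s ^ 2)) := by
  rw [← PHI_zero d β hβ0 hβd]
  obtain ⟨D, hD, hb⟩ := FF_bound d β hβ0 hβd
  have hPb : ∀ σ ∈ Icc (0 : ℝ) 1, ‖∫ p, FF d β σ p‖ ≤ ∫ p, D p := fun σ hσ =>
    norm_integral_le_of_norm_le hD (Eventually.of_forall (hb σ hσ))
  have hPm : Measurable (fun σ => ∫ p, FF d β σ p) :=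
    (StronglyMeasurable.integral_prod_right (f := fun σ p => FF d β σ p)
      (FF_meas d β).stronglyMeasurable).measurable
  have hσ : ∀ R : ℝ, max 1 (√t) ≤ R → ∀ s ∈ Ioc (0 : ℝ) t, √(t - s) / R ∈ Icc (0 : ℝ) 1 := by
    intro R hR s hs
    have hR0 : 0 < R := lt_of_lt_of_le (by positivity) ((le_max_left _ _).trans hR)
    refine ⟨by positivity, (div_le_one hR0).2 ?_⟩
    exact (Real.sqrt_le_sqrt (by linarith [hs.1])).trans ((le_max_right _ _).trans hR)
  have key : Tendsto (fun R : ℝ => ∫ s in Ioc (0 : ℝ) t, η s ^ 2 * ∫ p, FF d β (√(t - s) / R) p)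
      atTop (𝓝 (∫ s in Ioc (0 : ℝ) t, η s ^ 2 * ∫ p, FF d β 0 p)) := by
    apply tendsto_integral_filter_of_dominated_convergence (fun _ => M ^ 2 * ∫ p, D p)
    · refine Eventually.of_forall fun R => Measurable.aestronglyMeasurable ?_
      exact (hη_meas.pow_const 2).mul (hPm.comp (by fun_prop))
    · filter_upwards [eventually_ge_atTop (max 1 (√t))] with R hR
      filter_upwards [ae_restrict_mem measurableSet_Ioc] with s hs
      rw [norm_mul, norm_pow]
      have h1 := hη_bdd s ⟨hs.1.le, hs.2⟩
      rw [Real.norm_eq_abs (η s)]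
      gcongr
      exact hPb _ (hσ R hR s hs)
    · exact integrable_const _
    · filter_upwards [ae_restrict_mem measurableSet_Ioc] with s hs
      refine Tendsto.const_mul _ ((PHI_tendsto d β hβ0 hβd).comp ?_)
      refine tendsto_nhdsWithin_iff.2 ⟨tendsto_const_nhds.div_atTop tendsto_id, ?_⟩
      filter_upwards [eventually_ge_atTop (max 1 (√t))] with R hR using hσ R hR s hs
  rw [integral_mul_const, mul_comm] at key
  refine key.congr' ?_
  filter_upwards [eventually_ge_atTop (max 1 (√t))] with R hR
  have hR0 : 0 < R := lt_of_lt_of_le (by positivity) ((le_max_left _ _).trans hR)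
  rw [← integral_const_mul, integral_Ioc_eq_integral_Ioo, integral_Ioc_eq_integral_Ioo]
  refine setIntegral_congr_fun measurableSet_Ioo fun s hs => ?_
  rw [inner_eq d β hβ0 hβd (t - s) R (by linarith [hs.2]) hR0
    ((div_le_one hR0).1 (hσ R hR s ⟨hs.1, hs.2.le⟩).2)]
  have : R ^ (β - 2 * (d : ℝ)) * R ^ (2 * (d : ℝ) - β) = 1 := by
    rw [← rpow_add hR0, show β - 2 * (d : ℝ) + (2 * d - β) = 0 by ring, rpow_zero]
  calc _ = (R ^ (β - 2 * (d : ℝ)) * R ^ (2 * (d : ℝ) - β)) *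
        (η s ^ 2 * ∫ p, FF d β (√(t - s) / R) p) := by rw [this, one_mul]
    _ = _ := by ring
end

section
/- Let $0 < \beta < d$ and $t > 0$. Define for $R > 0$ the quantity $V_R = \int_0^t \int_{\mathbb{R}^{2d}} \varphi_R(s,y)\varphi_R(s,z)\, |y - z|^{-\beta} \, dy\, dz\, ds$ where $\varphi_R(s,y) = \int_{B_R} p_{t-s}(x - y)\, dx$. Then $\lim_{R \to \infty} R^{\beta - 2d} V_R = t\, k_\beta$, where $k_\beta = \int_{B_1^2} |x_1 - x_2|^{-\beta}\, dx_1\, dx_2$. -/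
open MeasureTheory Real Filter

namespace S16

noncomputable def ind (d : ℕ) : EuclideanSpace ℝ (Fin d) → ℝ :=
  (Metric.closedBall (0 : EuclideanSpace ℝ (Fin d)) 1).indicator (fun _ => 1)

noncomputable def psi (d : ℕ) (r : ℝ) (y : EuclideanSpace ℝ (Fin d)) : ℝ :=
  ∫ w, heatKernel d 1 w * ind d (y + r • w)

noncomputable def K (d : ℕ) (β r : ℝ) : ℝ :=
  ∫ y : EuclideanSpace ℝ (Fin d), ∫ z : EuclideanSpace ℝ (Fin d),
    psi d r y * psi d r z * ‖y - z‖ ^ (-β)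

variable {d : ℕ}

lemma ind_meas : Measurable (ind d) :=
  measurable_const.indicator Metric.isClosed_closedBall.measurableSet

lemma ind_nonneg (x) : 0 ≤ ind d x := Set.indicator_nonneg (fun _ _ => zero_le_one) x

lemma ind_le_one (x) : ind d x ≤ 1 := Set.indicator_le_self' (fun _ _ => zero_le_one) x

lemma hk_meas (t : ℝ) : Measurable (heatKernel d t) := by
  unfold heatKernel; fun_prop

lemma hk_nonneg {t : ℝ} (ht : 0 ≤ t) (x) : 0 ≤ heatKernel d t x := by
  unfold heatKernel; positivity

lemma gauss_int {b : ℝ} (hb : 0 < b) :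
    Integrable (fun v : EuclideanSpace ℝ (Fin d) => rexp (-b * ‖v‖ ^ 2)) := by
  by_contra h
  have h1 := GaussianFourier.integral_rexp_neg_mul_sq_norm (V := EuclideanSpace ℝ (Fin d)) hb
  rw [integral_undef h] at h1
  have : 0 < (π / b) ^ (Module.finrank ℝ (EuclideanSpace ℝ (Fin d)) / 2 : ℝ) := by positivity
  linarith

lemma hk_eq (w : EuclideanSpace ℝ (Fin d)) :
    heatKernel d 1 w = (2 * π) ^ (-(d : ℝ) / 2) * rexp (-(1/2) * ‖w‖ ^ 2) := by
  unfold heatKernel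
  congr 2
  · ring
  · ring

lemma hk_int : Integrable (heatKernel d 1) := by
  have := (gauss_int (d := d) (b := 1/2) (by norm_num)).const_mul ((2 * π) ^ (-(d : ℝ) / 2))
  exact this.congr (Eventually.of_forall fun w => (hk_eq w).symm)

lemma hk_one : ∫ w, heatKernel d 1 w = 1 := by
  simp_rw [hk_eq]
  rw [integral_const_mul, GaussianFourier.integral_rexp_neg_mul_sq_norm (by norm_num)]
  rw [finrank_euclideanSpace_fin, show π / (1/2) = 2 * π by ring,
    ← Real.rpow_add (by positivity)]
  ring_nf
  simp

lemma psi_integrable (r : ℝ) (y) :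
    Integrable (fun w => heatKernel d 1 w * ind d (y + r • w)) := by
  refine hk_int.mono' ?_ (Eventually.of_forall fun w => ?_)
  · exact ((hk_meas 1).mul (ind_meas.comp (by fun_prop))).aestronglyMeasurable
  · rw [Real.norm_of_nonneg (mul_nonneg (hk_nonneg zero_le_one _) (ind_nonneg _))]
    exact mul_le_of_le_one_right (hk_nonneg zero_le_one _) (ind_le_one _)

lemma psi_nonneg (r : ℝ) (y) : 0 ≤ psi d r y :=
  integral_nonneg fun _ => mul_nonneg (hk_nonneg zero_le_one _) (ind_nonneg _)

lemma psi_meas : Measurable (fun p : ℝ × EuclideanSpace ℝ (Fin d) => psi d p.1 p.2) := by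
  have : StronglyMeasurable (fun q : (ℝ × EuclideanSpace ℝ (Fin d)) × EuclideanSpace ℝ (Fin d) =>
      heatKernel d 1 q.2 * ind d (q.1.2 + q.1.1 • q.2)) := by
    apply Measurable.stronglyMeasurable
    exact ((hk_meas 1).comp measurable_snd).mul (ind_meas.comp (by fun_prop))
  exact this.integral_prod_right'.measurable

lemma psi_bound (d : ℕ) : ∃ C : ℝ, 0 ≤ C ∧ ∀ r : ℝ, |r| ≤ 1 → ∀ y, psi d r y ≤
    C * rexp (-(1/8) * ‖y‖ ^ 2) := by
  have hI : Integrable (fun w : EuclideanSpace ℝ (Fin d) =>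
      heatKernel d 1 w * rexp (1/4 + 1/4 * ‖w‖^2)) := by
    have := (gauss_int (d := d) (b := 1/4) (by norm_num)).const_mul
      ((2 * π) ^ (-(d : ℝ) / 2) * rexp (1/4))
    refine this.congr (Eventually.of_forall fun w => ?_)
    simp only [hk_eq]
    rw [mul_assoc, mul_assoc, ← Real.exp_add, ← Real.exp_add]
    ring_nf
  refine ⟨∫ w, heatKernel d 1 w * rexp (1/4 + 1/4 * ‖w‖^2),
    integral_nonneg fun _ => mul_nonneg (hk_nonneg zero_le_one _) (Real.exp_pos _).le, ?_⟩
  intro r hr y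
  rw [← integral_mul_const]
  refine integral_mono (psi_integrable r y) (hI.mul_const _) fun w => ?_
  simp only
  rw [mul_assoc]
  refine mul_le_mul_of_nonneg_left ?_ (hk_nonneg zero_le_one _)
  rw [← Real.exp_add]
  by_cases h : y + r • w ∈ Metric.closedBall (0 : EuclideanSpace ℝ (Fin d)) 1
  · refine (ind_le_one _).trans (Real.one_le_exp ?_)
    rw [mem_closedBall_zero_iff] at h
    have h1 : ‖y‖ ≤ 1 + ‖w‖ := by
      calc ‖y‖ = ‖(y + r • w) - r • w‖ := by simp
        _ ≤ ‖y + r • w‖ + ‖r • w‖ := norm_sub_le _ _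
        _ ≤ 1 + ‖w‖ := by
          rw [norm_smul, Real.norm_eq_abs]
          have := mul_le_mul_of_nonneg_right hr (norm_nonneg w)
          linarith
    have h2 := norm_nonneg y
    nlinarith [sq_nonneg (1 - ‖w‖), norm_nonneg w]
  · rw [ind, Set.indicator_of_notMem h]; positivity

lemma psi_tendsto (y : EuclideanSpace ℝ (Fin d)) (hy : ‖y‖ ≠ 1) :
    Tendsto (fun r => psi d r y) (nhds 0) (nhds (ind d y)) := by
  have h0 : ind d y = ∫ w, heatKernel d 1 w * ind d y := by
    rw [integral_mul_const, hk_one, one_mul]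
  rw [h0]
  refine tendsto_integral_filter_of_dominated_convergence (heatKernel d 1)
    (Eventually.of_forall fun r => (psi_integrable r y).aestronglyMeasurable)
    (Eventually.of_forall fun r => Eventually.of_forall fun w => ?_) hk_int
    (Eventually.of_forall fun w => ?_)
  · rw [Real.norm_of_nonneg (mul_nonneg (hk_nonneg zero_le_one _) (ind_nonneg _))]
    exact mul_le_of_le_one_right (hk_nonneg zero_le_one _) (ind_le_one _)
  · apply Tendsto.const_mul
    have hc : Tendsto (fun r : ℝ => ‖y + r • w‖) (nhds 0) (nhds ‖y‖) := by
      have : Continuous (fun r : ℝ => ‖y + r • w‖) := by fun_prop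
      simpa using this.tendsto 0
    apply tendsto_nhds_of_eventually_eq
    rcases lt_or_gt_of_ne hy with h | h
    · filter_upwards [hc.eventually_lt_const h] with r hr
      simp [ind, Set.indicator, h.le, hr.le]
    · filter_upwards [hc.eventually_const_lt h] with r hr
      simp [ind, Set.indicator, h.not_ge, hr.not_ge]

lemma riesz_loc {β : ℝ} (hβ0 : 0 < β) (hβd : β < d) :
    IntegrableOn (fun x : EuclideanSpace ℝ (Fin d) => ‖x‖ ^ (-β)) (Metric.ball 0 1) := by
  have hd : 0 < d := by
    have : (0:ℝ) < d := hβ0.trans hβd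
    exact_mod_cast this
  have : Nontrivial (EuclideanSpace ℝ (Fin d)) :=
    Module.nontrivial_of_finrank_pos (R := ℝ) (by simpa using hd)
  rw [integrableOn_fun_norm_addHaar volume (f := fun x : ℝ => x ^ (-β))]
  have : IntegrableOn (fun x : ℝ => x ^ ((d:ℝ) - 1 - β)) (Set.Ioo 0 1) :=
    (intervalIntegral.integrableOn_Ioo_rpow_iff zero_lt_one).2 (by linarith)
  refine this.congr_fun (fun x hx => ?_) measurableSet_Ioo
  simp only [finrank_euclideanSpace_fin, smul_eq_mul]
  rw [← Real.rpow_natCast, ← Real.rpow_add hx.1, Nat.cast_sub hd]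
  simp [sub_eq_add_neg]

lemma riesz_bound {β : ℝ} (hβ0 : 0 < β) (hβd : β < d) : ∃ C : ℝ, 0 ≤ C ∧
    ∀ y : EuclideanSpace ℝ (Fin d),
      Integrable (fun z => rexp (-(1/8) * ‖z‖ ^ 2) * ‖y - z‖ ^ (-β)) ∧
      ∫ z, rexp (-(1/8) * ‖z‖ ^ 2) * ‖y - z‖ ^ (-β) ≤ C := by
  set h : EuclideanSpace ℝ (Fin d) → ℝ :=
    (Metric.ball 0 1).indicator (fun x => ‖x‖ ^ (-β)) with hh
  have hi : Integrable h := (integrable_indicator_iff measurableSet_ball).2 (riesz_loc hβ0 hβd)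
  have hg := gauss_int (d := d) (b := 1/8) (by norm_num)
  have hhn : ∀ x, 0 ≤ h x := fun x => Set.indicator_nonneg (fun _ _ => by positivity) x
  refine ⟨(∫ z, h z) + ∫ z : EuclideanSpace ℝ (Fin d), rexp (-(1/8) * ‖z‖ ^ 2),
    add_nonneg (integral_nonneg hhn) (integral_nonneg fun _ => (Real.exp_pos _).le), fun y => ?_⟩
  have hs : Integrable (fun z => h (y - z)) := hi.comp_sub_left y
  have hb : ∀ z, rexp (-(1/8) * ‖z‖ ^ 2) * ‖y - z‖ ^ (-β) ≤
      h (y - z) + rexp (-(1/8) * ‖z‖ ^ 2) := by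
    intro z
    by_cases hz : y - z ∈ Metric.ball (0 : EuclideanSpace ℝ (Fin d)) 1
    · have e : h (y - z) = ‖y - z‖ ^ (-β) := Set.indicator_of_mem hz _
      rw [e]
      have h1 : rexp (-(1/8) * ‖z‖ ^ 2) ≤ 1 := Real.exp_le_one_iff.2 (by nlinarith [sq_nonneg ‖z‖])
      have h2 : 0 ≤ ‖y - z‖ ^ (-β) := by positivity
      have := mul_le_of_le_one_left h2 h1
      linarith [Real.exp_pos (-(1/8) * ‖z‖ ^ 2)]
    · have h1 : ‖y - z‖ ^ (-β) ≤ 1 := by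
        apply Real.rpow_le_one_of_one_le_of_nonpos _ (by linarith)
        simpa using hz
      have := mul_le_of_le_one_right (Real.exp_pos (-(1/8) * ‖z‖ ^ 2)).le h1
      linarith [hhn (y - z)]
  have hI : Integrable (fun z => rexp (-(1/8) * ‖z‖ ^ 2) * ‖y - z‖ ^ (-β)) := by
    refine (hs.add hg).mono' ?_ (Eventually.of_forall fun z => ?_)
    · apply Measurable.aestronglyMeasurable; fun_prop
    · rw [Real.norm_of_nonneg (by positivity)]; exact hb z
  refine ⟨hI, ?_⟩
  calc _ ≤ ∫ z, (h (y - z) + rexp (-(1/8) * ‖z‖ ^ 2)) := integral_mono hI (hs.add hg) hb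
    _ = _ := by rw [integral_add hs hg, integral_sub_left_eq_self h volume y]

lemma integrand_meas (β : ℝ) : StronglyMeasurable
    (fun q : (ℝ × EuclideanSpace ℝ (Fin d)) × EuclideanSpace ℝ (Fin d) =>
      psi d q.1.1 q.1.2 * psi d q.1.1 q.2 * ‖q.1.2 - q.2‖ ^ (-β)) := by
  apply Measurable.stronglyMeasurable
  refine ((psi_meas.comp measurable_fst).mul
    (psi_meas.comp (measurable_fst.fst.prodMk measurable_snd))).mul ?_
  fun_prop

lemma inner_meas (β : ℝ) : StronglyMeasurable (fun p : ℝ × EuclideanSpace ℝ (Fin d) =>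
    ∫ z : EuclideanSpace ℝ (Fin d), psi d p.1 p.2 * psi d p.1 z * ‖p.2 - z‖ ^ (-β)) :=
  (integrand_meas β).integral_prod_right'

lemma K_meas (β : ℝ) : StronglyMeasurable (K d β) :=
  (inner_meas β).integral_prod_right'

lemma inner_bound {β : ℝ} (hβ0 : 0 < β) (hβd : β < d) : ∃ C : ℝ, 0 ≤ C ∧
    ∀ r : ℝ, |r| ≤ 1 → ∀ y : EuclideanSpace ℝ (Fin d),
    ‖∫ z : EuclideanSpace ℝ (Fin d), psi d r y * psi d r z * ‖y - z‖ ^ (-β)‖ ≤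
      C * rexp (-(1/8) * ‖y‖ ^ 2) := by
  obtain ⟨C, hC, h1⟩ := psi_bound d
  obtain ⟨D, hD, h2⟩ := riesz_bound hβ0 hβd
  refine ⟨C * C * D, by positivity, fun r hr y => ?_⟩
  obtain ⟨hi, hb⟩ := h2 y
  calc _ ≤ ∫ z, (C * rexp (-(1/8) * ‖y‖ ^ 2) * C) *
        (rexp (-(1/8) * ‖z‖ ^ 2) * ‖y - z‖ ^ (-β)) := by
        refine norm_integral_le_of_norm_le (hi.const_mul _) (Eventually.of_forall fun z => ?_)
        have := psi_nonneg r y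
        have := psi_nonneg r z
        rw [Real.norm_of_nonneg (by positivity)]
        calc _ ≤ (C * rexp (-(1/8) * ‖y‖ ^ 2)) * (C * rexp (-(1/8) * ‖z‖ ^ 2)) *
                ‖y - z‖ ^ (-β) := by
              gcongr
              · exact h1 r hr y
              · exact h1 r hr z
          _ = _ := by ring
    _ ≤ (C * rexp (-(1/8) * ‖y‖ ^ 2) * C) * D := by
        rw [integral_const_mul]; gcongr
    _ = _ := by ring

lemma K_bound {β : ℝ} (hβ0 : 0 < β) (hβd : β < d) : ∃ C : ℝ, ∀ r : ℝ, |r| ≤ 1 →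
    ‖K d β r‖ ≤ C := by
  obtain ⟨C, hC, h⟩ := inner_bound hβ0 hβd
  exact ⟨_, fun r hr => norm_integral_le_of_norm_le
    ((gauss_int (d := d) (b := 1/8) (by norm_num)).const_mul C)
    (Eventually.of_forall fun y => h r hr y)⟩

lemma ae_norm_ne : ∀ᵐ y : EuclideanSpace ℝ (Fin d), ‖y‖ ≠ 1 := by
  have := Measure.addHaar_sphere_of_ne_zero (volume : Measure (EuclideanSpace ℝ (Fin d))) 0
    (one_ne_zero (α := ℝ))
  have h := measure_eq_zero_iff_ae_notMem.1 this
  filter_upwards [h] with y hy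
  simpa using hy

lemma ev_small : ∀ᶠ r : ℝ in nhds 0, |r| ≤ 1 := by
  filter_upwards [Metric.closedBall_mem_nhds (0:ℝ) one_pos] with r hr
  simpa using hr

lemma K_tendsto {β : ℝ} (hβ0 : 0 < β) (hβd : β < d) :
    Tendsto (K d β) (nhds 0) (nhds (∫ y : EuclideanSpace ℝ (Fin d),
      ∫ z : EuclideanSpace ℝ (Fin d), ind d y * ind d z * ‖y - z‖ ^ (-β))) := by
  obtain ⟨C, hC, h⟩ := inner_bound hβ0 hβd
  refine tendsto_integral_filter_of_dominated_convergence _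
    (Eventually.of_forall fun r =>
      ((inner_meas β).comp_measurable measurable_prodMk_left).aestronglyMeasurable)
    (ev_small.mono fun r hr => Eventually.of_forall fun y => h r hr y)
    ((gauss_int (d := d) (b := 1/8) (by norm_num)).const_mul C) ?_
  filter_upwards [ae_norm_ne] with y hy
  obtain ⟨C', hC', h1⟩ := psi_bound d
  obtain ⟨D, hD, h2⟩ := riesz_bound hβ0 hβd
  refine tendsto_integral_filter_of_dominated_convergence
    (fun z => (C' * rexp (-(1/8) * ‖y‖ ^ 2) * C') * (rexp (-(1/8) * ‖z‖ ^ 2) * ‖y - z‖ ^ (-β)))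
    (Eventually.of_forall fun r =>
      ((integrand_meas β).comp_measurable
        (measurable_prodMk_left (x := (r, y)))).aestronglyMeasurable)
    (ev_small.mono fun r hr => Eventually.of_forall fun z => ?_)
    ((h2 y).1.const_mul _) ?_
  · have := psi_nonneg r y
    have := psi_nonneg r z
    rw [Real.norm_of_nonneg (by positivity)]
    calc _ ≤ (C' * rexp (-(1/8) * ‖y‖ ^ 2)) * (C' * rexp (-(1/8) * ‖z‖ ^ 2)) *
                ‖y - z‖ ^ (-β) := by
              gcongr
              · exact h1 r hr y
              · exact h1 r hr z
          _ = _ := by ring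
  · filter_upwards [ae_norm_ne] with z hz
    exact ((psi_tendsto y hy).mul (psi_tendsto z hz)).mul_const _

lemma limit_eq (β : ℝ) : (∫ y : EuclideanSpace ℝ (Fin d),
      ∫ z : EuclideanSpace ℝ (Fin d), ind d y * ind d z * ‖y - z‖ ^ (-β)) =
    ∫ x₁ in Metric.closedBall (0 : EuclideanSpace ℝ (Fin d)) 1,
          ∫ x₂ in Metric.closedBall (0 : EuclideanSpace ℝ (Fin d)) 1,
            ‖x₁ - x₂‖ ^ (-β) := by
  rw [← integral_indicator measurableSet_closedBall]
  congr 1; ext y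
  by_cases hy : y ∈ Metric.closedBall (0 : EuclideanSpace ℝ (Fin d)) 1
  · rw [Set.indicator_of_mem hy, ← integral_indicator measurableSet_closedBall]
    congr 1; ext z
    simp only [ind, Set.indicator_of_mem hy]
    simp [Set.indicator]
  · simp [ind, Set.indicator_of_notMem hy]

lemma int_smul {c : ℝ} (hc : 0 < c) (f : EuclideanSpace ℝ (Fin d) → ℝ) :
    ∫ x, f x = c ^ d * ∫ x, f (c • x) := by
  rw [Measure.integral_comp_smul_of_nonneg volume f c (hR := hc.le), finrank_euclideanSpace_fin,
    smul_eq_mul, ← mul_assoc, mul_inv_cancel₀ (by positivity), one_mul]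

lemma hk_scale {τ : ℝ} (hτ : 0 < τ) (w : EuclideanSpace ℝ (Fin d)) :
    √τ ^ d * heatKernel d τ (√τ • w) = heatKernel d 1 w := by
  unfold heatKernel
  rw [norm_smul, Real.norm_of_nonneg (Real.sqrt_nonneg _), mul_pow, Real.sq_sqrt hτ.le,
    Real.mul_rpow (by positivity) hτ.le, ← mul_assoc]
  have e : √τ ^ d * ((2 * π) ^ (-(d:ℝ) / 2) * τ ^ (-(d:ℝ) / 2)) = (2 * π * 1) ^ (-(d:ℝ) / 2) := by
    rw [← Real.rpow_natCast, Real.sqrt_eq_rpow, ← Real.rpow_mul hτ.le, mul_left_comm,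
      ← Real.rpow_add hτ]
    ring_nf
    simp
  rw [e]
  congr 2
  field_simp

lemma phi_scale {τ R : ℝ} (hτ : 0 < τ) (hR : 0 < R) (y : EuclideanSpace ℝ (Fin d)) :
    (∫ x in Metric.closedBall (0 : EuclideanSpace ℝ (Fin d)) R, heatKernel d τ (x - R • y))
      = psi d (√τ / R) y := by
  have hs : 0 < √τ := Real.sqrt_pos.2 hτ
  rw [← integral_indicator measurableSet_closedBall,
    ← integral_add_right_eq_self _ (R • y), int_smul hs, ← integral_const_mul]
  unfold psi
  congr 1; ext w
  have e : √τ • w + R • y = R • (y + (√τ / R) • w) := by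
    rw [smul_add, smul_smul, mul_div_cancel₀ _ hR.ne', add_comm]
  have hm : √τ • w + R • y ∈ Metric.closedBall (0 : EuclideanSpace ℝ (Fin d)) R ↔
      y + (√τ / R) • w ∈ Metric.closedBall (0 : EuclideanSpace ℝ (Fin d)) 1 := by
    rw [e, mem_closedBall_zero_iff, mem_closedBall_zero_iff, norm_smul,
      Real.norm_of_nonneg hR.le]
    exact mul_le_iff_le_one_right hR
  by_cases h : y + (√τ / R) • w ∈ Metric.closedBall (0 : EuclideanSpace ℝ (Fin d)) 1
  · rw [Set.indicator_of_mem (hm.2 h), ind, Set.indicator_of_mem h, add_sub_cancel_right,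
      hk_scale hτ, mul_one]
  · rw [Set.indicator_of_notMem (fun h' => h (hm.1 h')), ind, Set.indicator_of_notMem h]
    simp

lemma scale {β τ R : ℝ} (hτ : 0 < τ) (hR : 0 < R) :
    R ^ (β - 2 * d) * (∫ y : EuclideanSpace ℝ (Fin d), ∫ z : EuclideanSpace ℝ (Fin d),
              (∫ x in Metric.closedBall (0 : EuclideanSpace ℝ (Fin d)) R,
                heatKernel d τ (x - y)) *
              (∫ x in Metric.closedBall (0 : EuclideanSpace ℝ (Fin d)) R,
                heatKernel d τ (x - z)) * ‖y - z‖ ^ (-β)) = K d β (√τ / R) := by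
  rw [int_smul hR, K, ← integral_const_mul, ← integral_const_mul]
  congr 1; ext y
  rw [int_smul hR, ← integral_const_mul, ← integral_const_mul, ← integral_const_mul]
  congr 1; ext z
  rw [phi_scale hτ hR, phi_scale hτ hR, ← smul_sub, norm_smul, Real.norm_of_nonneg hR.le,
    Real.mul_rpow hR.le (norm_nonneg _)]
  have e : R ^ (β - 2 * d) * (R ^ d * (R ^ d * R ^ (-β))) = 1 := by
    rw [← Real.rpow_natCast, ← Real.rpow_add hR, ← Real.rpow_add hR, ← Real.rpow_add hR]
    ring_nf
    simp
  linear_combination (psi d (√τ / R) y * psi d (√τ / R) z * ‖y - z‖ ^ (-β)) * e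

end S16

/-- Variance asymptotics for the first chaos: with
`V_R = ∫₀ᵗ ∫∫ φ_R(s,y) φ_R(s,z) |y-z|^{-β} dy dz ds`, where
`φ_R(s,y) = ∫_{B_R} p_{t-s}(x-y) dx`, one has `R^{β-2d} V_R → t k_β`. -/
theorem stmt_16 (d : ℕ) (β : ℝ) (hβ0 : 0 < β) (hβd : β < d) (t : ℝ) (ht : 0 < t) :
    Tendsto (fun R : ℝ =>
        R ^ (β - 2 * d) *
          ∫ s in Set.Ioc (0 : ℝ) t,
            ∫ y : EuclideanSpace ℝ (Fin d), ∫ z : EuclideanSpace ℝ (Fin d),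
              (∫ x in Metric.closedBall (0 : EuclideanSpace ℝ (Fin d)) R,
                heatKernel d (t - s) (x - y)) *
              (∫ x in Metric.closedBall (0 : EuclideanSpace ℝ (Fin d)) R,
                heatKernel d (t - s) (x - z)) * ‖y - z‖ ^ (-β))
      atTop
      (nhds (t * ∫ x₁ in Metric.closedBall (0 : EuclideanSpace ℝ (Fin d)) 1,
          ∫ x₂ in Metric.closedBall (0 : EuclideanSpace ℝ (Fin d)) 1,
            ‖x₁ - x₂‖ ^ (-β))) := by
  have hmain : Tendsto (fun R : ℝ => ∫ s in Set.Ioc (0 : ℝ) t, S16.K d β (√(t - s) / R)) atTop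
      (nhds (∫ s in Set.Ioc (0 : ℝ) t, ∫ y : EuclideanSpace ℝ (Fin d),
        ∫ z : EuclideanSpace ℝ (Fin d), S16.ind d y * S16.ind d z * ‖y - z‖ ^ (-β))) := by
    obtain ⟨C, hC⟩ := S16.K_bound hβ0 hβd
    refine tendsto_integral_filter_of_dominated_convergence (fun _ => C)
      (Eventually.of_forall fun R => ?_) ?_ (integrable_const C)
      (Eventually.of_forall fun s => ?_)
    · exact ((S16.K_meas β).comp_measurable (by fun_prop)).aestronglyMeasurable
    · filter_upwards [eventually_ge_atTop √t, eventually_gt_atTop 0] with R hR hR0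
      filter_upwards [ae_restrict_mem measurableSet_Ioc] with s hs
      apply hC
      rw [abs_of_nonneg (by positivity), div_le_one hR0]
      exact (Real.sqrt_le_sqrt (by linarith [hs.1])).trans hR
    · exact (S16.K_tendsto hβ0 hβd).comp (tendsto_const_nhds.div_atTop tendsto_id)
  rw [S16.limit_eq, setIntegral_const] at hmain
  have hv : (volume : Measure ℝ).real (Set.Ioc 0 t) = t := by simp [ht.le]
  rw [hv, smul_eq_mul] at hmain
  refine hmain.congr' ?_
  filter_upwards [eventually_gt_atTop 0] with R hR
  rw [← integral_const_mul]
  apply integral_congr_ae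
  filter_upwards [ae_restrict_mem measurableSet_Ioc,
    ae_restrict_of_ae (Measure.ae_ne volume t)] with s hs hst
  exact (S16.scale (sub_pos.2 (lt_of_le_of_ne hs.2 hst)) hR).symm
end

section
/- Let $0 < \beta < d$ and let $f: [0,\infty) \times \mathbb{R}^d \to \mathbb{R}$ be jointly measurable, adapted, and satisfy $|f(r,z)| \le C_0 p_{s-r}(z - y_0)$ for some fixed $s > 0$, $y_0 \in \mathbb{R}^d$, and all $0 \le r \le s$, $z \in \mathbb{R}^d$. Similarly let $g$ satisfy $|g(r,z)| \le C_0 p_{s-r}(z - y_1)$ with $y_1 \neq y_0$. Then $\int_0^s \int_{\mathbb{R}^{2d}} |f(r,\gamma)|\, |g(r,\lambda)|\, |\gamma - \lambda|^{-\beta}\, d\gamma\, d\lambda\, dr \le C\, C_0^2\, s\, |y_0 - y_1|^{-\beta}$ for a constant $C$ depending only on $d$ and $\beta$. -/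
open MeasureTheory Real

lemma hk_nonneg (d : ℕ) (t : ℝ) (ht : 0 < t) (x) : 0 ≤ heatKernel d t x := by
  unfold heatKernel; positivity

lemma hk_int (d : ℕ) (t : ℝ) (ht : 0 < t) : ∫ x, heatKernel d t x = 1 := by
  unfold heatKernel
  rw [integral_const_mul]
  have h := GaussianFourier.integral_rexp_neg_mul_sq_norm (V := EuclideanSpace ℝ (Fin d))
    (b := 1 / (2 * t)) (by positivity)
  have e : ∀ v : EuclideanSpace ℝ (Fin d), -‖v‖ ^ 2 / (2 * t) = -(1 / (2 * t)) * ‖v‖ ^ 2 := by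
    intro v; ring
  simp_rw [e]
  rw [h, finrank_euclideanSpace_fin]
  have : π / (1 / (2 * t)) = 2 * π * t := by field_simp
  rw [this, ← rpow_add (by positivity)]
  have : -(d : ℝ) / 2 + d / 2 = 0 := by ring
  rw [this, rpow_zero]

lemma hk_integrable (d : ℕ) (t : ℝ) (ht : 0 < t) : Integrable (heatKernel d t) := by
  by_contra h
  have := hk_int d t ht
  rw [integral_undef h] at this
  norm_num at this

lemma hk_le (d : ℕ) (hd : 0 < d) (t ρ : ℝ) (ht : 0 < t) (hρ : 0 < ρ)
    (x : EuclideanSpace ℝ (Fin d)) (hx : ρ ≤ ‖x‖) :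
    heatKernel d t x ≤ (π / ((d : ℝ) / 2)) ^ (-(d : ℝ) / 2) * ρ ^ (-(d : ℝ)) := by
  have hd' : (0 : ℝ) < d := by exact_mod_cast hd
  unfold heatKernel
  set q : ℝ := (d : ℝ) / 2 with hq
  have hq0 : 0 < q := by positivity
  have hw : 0 < ρ ^ 2 / (2 * t * q) := by positivity
  have h1 : ρ ^ 2 / (2 * t * q) ≤ exp (ρ ^ 2 / (2 * t * q)) := by
    linarith [add_one_le_exp (ρ ^ 2 / (2 * t * q))]
  have h2 : exp (-‖x‖ ^ 2 / (2 * t)) ≤ (ρ ^ 2 / (2 * t * q)) ^ (-q) := by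
    calc exp (-‖x‖ ^ 2 / (2 * t)) ≤ exp (-ρ ^ 2 / (2 * t)) := by gcongr
      _ = (exp (ρ ^ 2 / (2 * t * q))) ^ (-q) := by
        rw [← exp_mul]; congr 1; field_simp
      _ ≤ _ := rpow_le_rpow_of_nonpos hw h1 (by linarith)
  have e : -(d : ℝ) / 2 = -q := by rw [hq]; ring
  rw [e]
  calc _ ≤ (2 * π * t) ^ (-q) * (ρ ^ 2 / (2 * t * q)) ^ (-q) := by gcongr
    _ = (π / q * ρ ^ 2) ^ (-q) := by
      rw [← mul_rpow (by positivity) (by positivity)]; congr 1; field_simp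
    _ = _ := by
      rw [mul_rpow (by positivity) (by positivity), ← rpow_natCast, ← rpow_mul hρ.le]
      congr 2; rw [hq]; push_cast; ring

lemma ball_int (d : ℕ) (β ρ : ℝ) (hβd : β < d) (hd : 0 < d) (hρ : 0 < ρ) :
    Integrable (fun x : EuclideanSpace ℝ (Fin d) => (Set.Ioo 0 ρ).indicator (fun y => y ^ (-β)) ‖x‖) ∧
    ∫ x : EuclideanSpace ℝ (Fin d), (Set.Ioo 0 ρ).indicator (fun y => y ^ (-β)) ‖x‖
      = d * volume.real (Metric.ball (0 : EuclideanSpace ℝ (Fin d)) 1) * (ρ ^ (d - β) / (d - β)) := by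
  haveI : NeZero d := ⟨hd.ne'⟩
  have key : ∀ y ∈ Set.Ioi (0 : ℝ), y ^ (d - 1) • (Set.Ioo 0 ρ).indicator (fun y : ℝ => y ^ (-β)) y
      = (Set.Ioo 0 ρ).indicator (fun y : ℝ => y ^ (d - 1 - β)) y := by
    intro y hy
    rw [Set.mem_Ioi] at hy
    by_cases h : y ∈ Set.Ioo 0 ρ
    · rw [Set.indicator_of_mem h, Set.indicator_of_mem h, smul_eq_mul, ← rpow_natCast, ← rpow_add hy]
      congr 1
      rw [Nat.cast_sub hd]; push_cast; ring
    · simp [Set.indicator_of_notMem h]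
  constructor
  · rw [integrable_fun_norm_addHaar, finrank_euclideanSpace_fin]
    rw [integrableOn_congr_fun key measurableSet_Ioi]
    apply Integrable.integrableOn
    rw [integrable_indicator_iff measurableSet_Ioo]
    rw [intervalIntegral.integrableOn_Ioo_rpow_iff hρ]
    linarith
  · rw [integral_fun_norm_addHaar, finrank_euclideanSpace_fin, setIntegral_congr_fun measurableSet_Ioi key,
      setIntegral_indicator measurableSet_Ioo, Set.inter_eq_right.2 Set.Ioo_subset_Ioi_self,
      ← integral_Ioc_eq_integral_Ioo, ← intervalIntegral.integral_of_le hρ.le,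
      integral_rpow (Or.inl (by linarith))]
    have : (d : ℝ) - 1 - β + 1 = d - β := by ring
    rw [this, zero_rpow (by linarith)]
    simp [nsmul_eq_mul, mul_assoc]

lemma core (d : ℕ) (β : ℝ) (hβ0 : 0 < β) (hβd : β < d) :
    ∃ C : ℝ, 0 < C ∧ ∀ t : ℝ, 0 < t → ∀ a b : EuclideanSpace ℝ (Fin d), a ≠ b →
      Integrable (fun x => heatKernel d t (x - a) * ‖x - b‖ ^ (-β)) ∧
      ∫ x, heatKernel d t (x - a) * ‖x - b‖ ^ (-β) ≤ C * ‖a - b‖ ^ (-β) := by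
  have hd : 0 < d := by
    have : (0 : ℝ) < d := by linarith
    exact_mod_cast this
  have hdb : 0 < (d : ℝ) - β := by linarith
  set c : ℝ := (π / ((d : ℝ) / 2)) ^ (-(d : ℝ) / 2) with hc
  set V : ℝ := d * volume.real (Metric.ball (0 : EuclideanSpace ℝ (Fin d)) 1) with hV
  have hc0 : 0 ≤ c := by positivity
  have hV0 : 0 ≤ V := by positivity
  refine ⟨2 ^ β * (1 + c * V / (d - β)), by positivity, ?_⟩
  intro t ht a b hab
  have hR : 0 < ‖a - b‖ := norm_pos_iff.2 (sub_ne_zero.2 hab)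
  set ρ := ‖a - b‖ / 2 with hρd
  have hρ : 0 < ρ := by positivity
  obtain ⟨hi, hI⟩ := ball_int d β ρ hβd hd hρ
  let G : EuclideanSpace ℝ (Fin d) → ℝ := fun x => ρ ^ (-β) * heatKernel d t (x - a) +
    c * ρ ^ (-(d : ℝ)) * (Set.Ioo 0 ρ).indicator (fun y => y ^ (-β)) ‖x - b‖
  have i1 := (hk_integrable d t ht).comp_sub_right a
  have i2 := hi.comp_sub_right b
  have hG : Integrable G := (i1.const_mul _).add (i2.const_mul _)
  have hnn : ∀ x, 0 ≤ heatKernel d t (x - a) * ‖x - b‖ ^ (-β) := fun x =>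
    mul_nonneg (hk_nonneg d t ht _) (by positivity)
  have hle : ∀ x, heatKernel d t (x - a) * ‖x - b‖ ^ (-β) ≤ G x := by
    intro x
    have hk := hk_nonneg d t ht (x - a)
    by_cases h : ‖x - b‖ ∈ Set.Ioo 0 ρ
    · simp only [G, Set.indicator_of_mem h]
      have : ρ ≤ ‖x - a‖ := by
        have := norm_sub_le_norm_sub_add_norm_sub a x b
        rw [norm_sub_rev a x] at this
        have := h.2
        linarith
      have h1 := hk_le d hd t ρ ht hρ (x - a) this
      have h2 : heatKernel d t (x - a) * ‖x - b‖ ^ (-β) ≤ c * ρ ^ (-(d : ℝ)) * ‖x - b‖ ^ (-β) := by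
        gcongr
      have h3 : 0 ≤ ρ ^ (-β) * heatKernel d t (x - a) := by positivity
      linarith
    · simp only [G, Set.indicator_of_notMem h, mul_zero, add_zero]
      rw [mul_comm]
      refine mul_le_mul_of_nonneg_right ?_ hk
      rcases eq_or_lt_of_le (norm_nonneg (x - b)) with h0 | h0
      · rw [← h0, zero_rpow (by linarith)]; positivity
      · apply rpow_le_rpow_of_nonpos hρ _ (by linarith)
        by_contra h'
        exact h ⟨h0, not_le.1 h'⟩
  have hmeas : AEStronglyMeasurable (fun x => heatKernel d t (x - a) * ‖x - b‖ ^ (-β)) := by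
    unfold heatKernel
    apply Measurable.aestronglyMeasurable
    fun_prop
  refine ⟨hG.mono' hmeas (Filter.Eventually.of_forall fun x => ?_), ?_⟩
  · rw [norm_of_nonneg (hnn x)]; exact hle x
  · refine (integral_mono_of_nonneg (Filter.Eventually.of_forall hnn) hG
      (Filter.Eventually.of_forall hle)).trans (le_of_eq ?_)
    simp only [G]
    rw [integral_add (i1.const_mul _) (i2.const_mul _), integral_const_mul, integral_const_mul,
      integral_sub_right_eq_self (fun x => heatKernel d t x) a, hk_int d t ht,
      integral_sub_right_eq_self (fun x : EuclideanSpace ℝ (Fin d) =>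
        (Set.Ioo 0 ρ).indicator (fun y => y ^ (-β)) ‖x‖) b, hI, ← hV]
    have e1 : ρ ^ ((d : ℝ) - β) = ρ ^ (d : ℝ) * ρ ^ (-β) := by
      rw [← rpow_add hρ]; congr 1
    have e2 : ρ ^ (-(d : ℝ)) * ρ ^ (d : ℝ) = 1 := by
      rw [← rpow_add hρ]; simp
    have e3 : ρ ^ (-β) = 2 ^ β * ‖a - b‖ ^ (-β) := by
      rw [hρd, div_rpow hR.le (by norm_num), rpow_neg (by norm_num : (0:ℝ) ≤ 2)]
      field_simp
    rw [e1]
    calc _ = ρ ^ (-β) * (1 + c * V / (d - β) * (ρ ^ (-(d : ℝ)) * ρ ^ (d : ℝ))) := by ring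
      _ = _ := by rw [e2, e3]; ring

theorem stmt_17 (d : ℕ) (β : ℝ) (hβ0 : 0 < β) (hβd : β < d) :
    ∃ C : ℝ, 0 < C ∧ ∀ s : ℝ, 0 < s → ∀ y₀ y₁ : EuclideanSpace ℝ (Fin d), y₀ ≠ y₁ →
      ∀ C₀ : ℝ, 0 ≤ C₀ →
      ∀ f g : ℝ → EuclideanSpace ℝ (Fin d) → ℝ,
        Measurable (Function.uncurry f) → Measurable (Function.uncurry g) →
        (∀ r ∈ Set.Ico (0 : ℝ) s, ∀ z, |f r z| ≤ C₀ * heatKernel d (s - r) (z - y₀)) →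
        (∀ r ∈ Set.Ico (0 : ℝ) s, ∀ z, |g r z| ≤ C₀ * heatKernel d (s - r) (z - y₁)) →
        (∫ r in Set.Ioc (0 : ℝ) s,
            ∫ γ : EuclideanSpace ℝ (Fin d), ∫ l : EuclideanSpace ℝ (Fin d),
              |f r γ| * |g r l| * ‖γ - l‖ ^ (-β))
          ≤ C * C₀ ^ 2 * s * ‖y₀ - y₁‖ ^ (-β) := by
  obtain ⟨C, hC, H⟩ := core d β hβ0 hβd
  refine ⟨C ^ 2, by positivity, ?_⟩
  intro s hs y₀ y₁ hy C₀ hC₀ f g _ _ hf hg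
  have hdne : Nontrivial (EuclideanSpace ℝ (Fin d)) := ⟨y₀, y₁, hy⟩
  have main : ∀ r ∈ Set.Ico (0 : ℝ) s,
      (∫ γ : EuclideanSpace ℝ (Fin d), ∫ l : EuclideanSpace ℝ (Fin d),
        |f r γ| * |g r l| * ‖γ - l‖ ^ (-β)) ≤ C ^ 2 * C₀ ^ 2 * ‖y₀ - y₁‖ ^ (-β) := by
    intro r hr
    have ht : 0 < s - r := by linarith [hr.2]
    obtain ⟨hi, hI⟩ := H (s - r) ht y₀ y₁ hy
    calc _ ≤ ∫ γ, C₀ ^ 2 * C * (heatKernel d (s - r) (γ - y₀) * ‖γ - y₁‖ ^ (-β)) := by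
          refine integral_mono_of_nonneg (Filter.Eventually.of_forall fun γ =>
            integral_nonneg fun l => by positivity) (hi.const_mul _) ?_
          have hne : ∀ᵐ γ : EuclideanSpace ℝ (Fin d), γ ≠ y₁ := by
            simp [ae_iff]
          filter_upwards [hne] with γ hγ
          obtain ⟨hi', hI'⟩ := H (s - r) ht y₁ γ hγ.symm
          have hk := hk_nonneg d (s - r) ht (γ - y₀)
          have h1 : (∫ l : EuclideanSpace ℝ (Fin d), |f r γ| * |g r l| * ‖γ - l‖ ^ (-β)) ≤
              ∫ l, (C₀ * heatKernel d (s - r) (γ - y₀) * C₀) *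
                (heatKernel d (s - r) (l - y₁) * ‖l - γ‖ ^ (-β)) := by
            refine integral_mono_of_nonneg (Filter.Eventually.of_forall fun l => by positivity)
              (hi'.const_mul _) (Filter.Eventually.of_forall fun l => ?_)
            have := mul_le_mul (hf r hr γ) (hg r hr l) (abs_nonneg _) (by positivity)
            have := mul_le_mul_of_nonneg_right this
              (by positivity : 0 ≤ ‖γ - l‖ ^ (-β))
            refine this.trans (le_of_eq ?_)
            rw [norm_sub_rev γ l]; ring
          rw [integral_const_mul] at h1
          refine h1.trans ((mul_le_mul_of_nonneg_left hI' (by positivity)).trans (le_of_eq ?_))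
          rw [norm_sub_rev y₁ γ]; ring
      _ = C₀ ^ 2 * C * ∫ γ, heatKernel d (s - r) (γ - y₀) * ‖γ - y₁‖ ^ (-β) := integral_const_mul _ _
      _ ≤ C₀ ^ 2 * C * (C * ‖y₀ - y₁‖ ^ (-β)) := by gcongr
      _ = _ := by ring
  calc _ ≤ ∫ r in Set.Ioc (0 : ℝ) s, C ^ 2 * C₀ ^ 2 * ‖y₀ - y₁‖ ^ (-β) := by
        rw [integral_Ioc_eq_integral_Ioo, integral_Ioc_eq_integral_Ioo]
        refine integral_mono_of_nonneg (Filter.Eventually.of_forall fun r =>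
          integral_nonneg fun γ => integral_nonneg fun l => by positivity)
          (integrable_const _) ?_
        filter_upwards [ae_restrict_mem measurableSet_Ioo] with r hr
        exact main r ⟨hr.1.le, hr.2⟩
    _ = _ := by
        rw [setIntegral_const]
        simp [hs.le]; ring
end
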